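/- arXiv:1711.02118 — 2 statements merged into one kernel-verified Lean document; each statement's English description precedes it below -/
import Mathlib

section
/- Let θ₁, θ₂ ∈ (0, π) be real numbers such that 1, θ₁/(2π), θ₂/(2π) are linearly independent over ℚ. For i = 1, 2 and each positive integer ν define λᵢ(ν) = sin((ν+1)θᵢ)/sin(θᵢ). Then lim_{x→∞} (1/x)·#{ν ≤ x : λ₁(ν)·λ₂(ν) > 0} = 1/2. -/
open Real Filter

/-- Simultaneous Dirichlet approximation, without a rate. -/
lemma exists_pos_nat_mul_near_int_pair (α β : ℝ) {δ : ℝ} (hδ : 0 < δ) :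
    ∃ h : ℕ, 0 < h ∧ ∃ a b : ℤ, |h * α - a| < δ ∧ |h * β - b| < δ := by
  have hmem : ∀ n : ℕ, (Int.fract (n * α), Int.fract (n * β)) ∈
      (Set.Icc 0 1 ×ˢ Set.Icc 0 1 : Set (ℝ × ℝ)) := fun n =>
    ⟨⟨Int.fract_nonneg _, (Int.fract_lt_one _).le⟩, ⟨Int.fract_nonneg _, (Int.fract_lt_one _).le⟩⟩
  obtain ⟨p, -, φ, hφ, hlim⟩ := (isCompact_Icc.prod isCompact_Icc).tendsto_subseq hmem
  obtain ⟨N, hN⟩ := Metric.cauchySeq_iff.1 hlim.cauchySeq δ hδ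
  have hlt : φ N < φ (N + 1) := hφ (Nat.lt_succ_self N)
  have hd := hN (N + 1) (Nat.le_succ N) N le_rfl
  simp only [Function.comp_apply, Prod.dist_eq, max_lt_iff, Real.dist_eq] at hd
  refine ⟨φ (N + 1) - φ N, Nat.sub_pos_of_lt hlt,
    ⌊φ (N + 1) * α⌋ - ⌊φ N * α⌋, ⌊φ (N + 1) * β⌋ - ⌊φ N * β⌋, ?_, ?_⟩
  · refine (congrArg abs ?_).trans_lt hd.1
    rw [Nat.cast_sub hlt.le, Int.fract, Int.fract]
    push_cast
    ring
  · refine (congrArg abs ?_).trans_lt hd.2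
    rw [Nat.cast_sub hlt.le, Int.fract, Int.fract]
    push_cast
    ring

/-- An instance of Kronecker's theorem: if `1, α, β` are linearly independent over `ℚ`, then
some multiple of `(α, β)` is close to `(1/2, 0)` modulo `ℤ²`. -/
lemma exists_nat_mul_near_half_and_int {α β : ℝ}
    (hind : ∀ a b c : ℚ, (a : ℝ) + b * α + c * β = 0 → a = 0 ∧ b = 0 ∧ c = 0)
    {δ : ℝ} (hδ : 0 < δ) :
    ∃ m : ℕ, ∃ a b : ℤ, |m * α - 1 / 2 - a| < δ ∧ |m * β - b| < δ := by
  obtain ⟨h, hpos, a, b, ha, hb⟩ := exists_pos_nat_mul_near_int_pair α β (half_pos hδ)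
  have hh : (h : ℚ) ≠ 0 := by positivity
  set x : ℝ := h * α - a with hx
  set y : ℝ := h * β - b with hy
  have hy0 : y ≠ 0 := fun h0 => hh (hind (-b) 0 h (by push_cast; linarith)).2.2
  have hirr : Irrational (x / y) := by
    rintro ⟨q, hq⟩
    have hxy : x = q * y := by rw [hq, div_mul_cancel₀ _ hy0]
    refine hh (hind (-a + q * b) h (-(q * h)) ?_).2.1
    push_cast
    linear_combination hxy
  have hdense : Dense (AddSubgroup.closure {x, y} : Set ℝ) :=
    dense_addSubgroupClosure_pair_iff.2 hirr
  obtain ⟨z, hz, hzd⟩ := hdense.exists_dist_lt (y / 2) (mul_pos (half_pos hδ) (abs_pos.2 hy0))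
  obtain ⟨k, l, rfl⟩ := AddSubgroup.mem_closure_pair.1 hz
  have hkl : |k * (x / y) - 1 / 2 + l| < δ / 2 := by
    rw [Real.dist_eq, abs_sub_comm] at hzd
    rw [← mul_lt_mul_iff_left₀ (abs_pos.2 hy0), ← abs_mul]
    refine (congrArg abs ?_).trans_lt hzd
    simp only [zsmul_eq_mul]
    field_simp
    ring
  set j : ℤ := round (k / y) with hj
  have hround : |k / y - j| ≤ 1 / 2 := abs_sub_round _
  have hjx : |(j * h : ℤ) * α - 1 / 2 - (j * a - l : ℤ)| < δ := by
    have e : (j * h : ℤ) * α - 1 / 2 - (j * a - l : ℤ)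
        = (k * (x / y) - 1 / 2 + l) - (k / y - j) * x := by
      push_cast
      rw [hx]
      ring
    rw [e]
    refine (abs_sub _ _).trans_lt ?_
    rw [abs_mul]
    nlinarith [abs_nonneg x, abs_nonneg (k / y - j)]
  have hjy : |(j * h : ℤ) * β - (j * b + k : ℤ)| < δ := by
    have e : (j * h : ℤ) * β - (j * b + k : ℤ) = - ((k / y - j) * y) := by
      have : k / y * y = k := div_mul_cancel₀ _ hy0
      rw [sub_mul, this, hy]
      push_cast
      ring
    rw [e, abs_neg, abs_mul]
    nlinarith [abs_nonneg y, abs_nonneg (k / y - j)]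
  obtain ⟨m, hm | hm⟩ := Int.eq_nat_or_neg (j * h)
  · rw [hm] at hjx hjy
    exact ⟨m, _, _, mod_cast hjx, mod_cast hjy⟩
  · rw [hm] at hjx hjy
    refine ⟨m, -(j * a - l) - 1, -(j * b + k), ?_, ?_⟩
    · rw [← abs_neg]
      refine (congrArg abs ?_).trans_lt hjx
      push_cast
      ring
    · rw [← abs_neg]
      refine (congrArg abs ?_).trans_lt hjy
      push_cast
      ring

lemma card_filter_range_le_of_separated {p : ℕ → Prop} [DecidablePred p] {K : ℕ} (hK : 0 < K)
    (hp : ∀ n k, 0 < k → k < K → p n → ¬ p (n + k)) (N : ℕ) :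
    ((Finset.range N).filter p).card ≤ N / K + 1 := by
  rw [← Finset.card_range (N / K + 1)]
  have key : ∀ n n', p n → p n' → n / K = n' / K → n ≤ n' → n = n' := by
    intro n n' hn hn' he hle
    by_contra hne
    refine hp n (n' - n) (by omega) ?_ hn (by rwa [Nat.add_sub_cancel' hle])
    have h1 := Nat.div_add_mod n K
    have h2 := Nat.div_add_mod n' K
    have h3 := Nat.mod_lt n' hK
    rw [he] at h1
    omega
  refine Finset.card_le_card_of_injOn (· / K) ?_ ?_
  · intro n hn
    simp only [Finset.coe_filter, Finset.mem_range, Set.mem_ofPred_eq] at hn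
    simpa [Nat.lt_succ_iff] using Nat.div_le_div_right hn.1.le
  · intro n hn n' hn' he
    simp only [Finset.coe_filter, Set.mem_ofPred_eq] at hn hn'
    rcases le_total n n' with h | h
    · exact key n n' hn.2 hn'.2 he h
    · exact (key n' n hn'.2 hn.2 he.symm h).symm

lemma exists_pos_card_abs_sin_le {θ : ℝ} (hθ : ∀ n : ℕ, 0 < n → sin (n * θ) ≠ 0)
    {K : ℕ} (hK : 0 < K) :
    ∃ δ : ℝ, 0 < δ ∧ ∀ N : ℕ,
      ((Finset.range N).filter (fun n : ℕ => |sin (n * θ)| ≤ δ)).card ≤ N / K + 1 := by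
  obtain ⟨ε, hε, hmin⟩ : ∃ ε : ℝ, 0 < ε ∧ ∀ k ∈ Finset.Ioo 0 K, ε < |sin (k * θ)| := by
    have h : ∀ᶠ ε : ℝ in nhdsWithin 0 (Set.Ioi 0), ∀ k ∈ Finset.Ioo 0 K, ε < |sin (k * θ)| := by
      rw [Filter.eventually_all_finset]
      intro k hk
      exact nhdsWithin_le_nhds (Iio_mem_nhds (abs_pos.2 (hθ k (Finset.mem_Ioo.1 hk).1)))
    obtain ⟨ε, h1, h2⟩ := (h.and self_mem_nhdsWithin).exists
    exact ⟨ε, h2, h1⟩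
  refine ⟨ε / 2, half_pos hε, fun N => card_filter_range_le_of_separated hK ?_ N⟩
  intro n k hk hkK hn hnk
  refine (hmin k (Finset.mem_Ioo.2 ⟨hk, hkK⟩)).not_ge ?_
  have e : sin (k * θ) =
      sin ((n + k : ℕ) * θ) * cos (n * θ) - cos ((n + k : ℕ) * θ) * sin (n * θ) := by
    rw [← sin_sub]
    congr 1
    push_cast
    ring
  rw [e]
  refine (abs_sub _ _).trans ?_
  rw [abs_mul, abs_mul]
  nlinarith [abs_cos_le_one (n * θ), abs_cos_le_one ((n + k : ℕ) * θ),
    abs_nonneg (sin (n * θ)), abs_nonneg (sin ((n + k : ℕ) * θ))]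

lemma sign_sin_eq_of_abs_sub_lt {x y : ℝ} (h : |y - x| < |sin x|) :
    SignType.sign (sin y) = SignType.sign (sin x) := by
  have hl : |sin y - sin x| < |sin x| := (abs_sin_sub_sin_le y x).trans_lt h
  rcases lt_trichotomy (sin x) 0 with hx | hx | hx
  · rw [abs_of_neg hx, abs_lt] at hl
    rw [sign_neg hx, sign_neg (by linarith)]
  · rw [hx, abs_zero] at hl
    exact absurd hl (abs_nonneg _).not_gt
  · rw [abs_of_pos hx, abs_lt] at hl
    rw [sign_pos hx, sign_pos (by linarith)]

lemma abs_sum_range_le_of_antiperiodic {a : ℕ → ℝ} (ha : ∀ n, |a n| ≤ 1) {m : ℕ}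
    {p : ℕ → Prop} [DecidablePred p] (h : ∀ n, ¬ p n → a (n + m) = - a n) (N : ℕ) :
    |∑ n ∈ Finset.range N, a n| ≤ ((Finset.range N).filter p).card + m := by
  have hle : ∀ f : ℕ → ℝ, (∀ n, |f n| ≤ 1) → |∑ n ∈ Finset.range m, f n| ≤ m := fun f hf =>
    (Finset.abs_sum_le_sum_abs _ _).trans
      ((Finset.sum_le_sum fun n _ => hf n).trans (by simp))
  have h1 := hle a ha
  have h2 := hle (fun n => a (N + n)) fun n => ha _
  have h3 : ∑ n ∈ Finset.range N, a n + ∑ n ∈ Finset.range m, a (N + n)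
      = ∑ n ∈ Finset.range m, a n + ∑ n ∈ Finset.range N, a (n + m) := by
    rw [← Finset.sum_range_add, add_comm N m, Finset.sum_range_add]
    simp only [add_comm m]
  have h4 : |∑ n ∈ Finset.range N, (a n + a (n + m))| ≤ 2 * ((Finset.range N).filter p).card := by
    refine (Finset.abs_sum_le_sum_abs _ _).trans ?_
    rw [Finset.card_filter, Nat.cast_sum, Finset.mul_sum]
    refine Finset.sum_le_sum fun n _ => ?_
    by_cases hn : p n
    · simpa [hn] using (abs_add_le _ _).trans
        (show |a n| + |a (n + m)| ≤ 2 by linarith [ha n, ha (n + m)])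
    · simp [hn, h n hn]
  rw [Finset.sum_add_distrib] at h4
  rw [abs_le] at *
  constructor <;> linarith

/-- The signs of `sin (n θ₁) sin (n θ₂)` have mean value zero. -/
lemma tendsto_mean_sign_sin_mul_sin {θ₁ θ₂ : ℝ}
    (hind : ∀ a b c : ℚ,
      (a : ℝ) + (b : ℝ) * (θ₁ / (2 * π)) + (c : ℝ) * (θ₂ / (2 * π)) = 0 → a = 0 ∧ b = 0 ∧ c = 0)
    (h₁ : ∀ n : ℕ, 0 < n → sin (n * θ₁) ≠ 0) (h₂ : ∀ n : ℕ, 0 < n → sin (n * θ₂) ≠ 0) :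
    Tendsto (fun N : ℕ => (∑ n ∈ Finset.range N,
      (SignType.sign (sin (n * θ₁) * sin (n * θ₂)) : ℝ)) / N) atTop (nhds 0) := by
  set a : ℕ → ℝ := fun n => (SignType.sign (sin (n * θ₁) * sin (n * θ₂)) : ℝ) with ha
  have habs : ∀ n, |a n| ≤ 1 := fun n => by
    simp only [ha]
    generalize SignType.sign (sin (n * θ₁) * sin (n * θ₂)) = s
    cases s <;> simp
  have bound : ∀ K : ℕ, 0 < K → ∃ m : ℕ, ∀ N : ℕ,
      |∑ n ∈ Finset.range N, a n| ≤ 2 * (N / K + 1) + m := by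
    intro K hK
    obtain ⟨δ₁, hδ₁, hc₁⟩ := exists_pos_card_abs_sin_le h₁ hK
    obtain ⟨δ₂, hδ₂, hc₂⟩ := exists_pos_card_abs_sin_le h₂ hK
    have hπ : 0 < 2 * π := two_pi_pos
    obtain ⟨m, u, v, hu, hv⟩ := exists_nat_mul_near_half_and_int hind
      (δ := min δ₁ δ₂ / (2 * π)) (by positivity)
    have hu' : |m * θ₁ - π - u * (2 * π)| < δ₁ := by
      refine lt_of_lt_of_le ?_ (min_le_left δ₁ δ₂)
      rw [lt_div_iff₀ hπ, ← abs_of_pos hπ, ← abs_mul, abs_of_pos hπ] at hu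
      refine (congrArg abs ?_).trans_lt hu
      field_simp
    have hv' : |m * θ₂ - v * (2 * π)| < δ₂ := by
      refine lt_of_lt_of_le ?_ (min_le_right δ₁ δ₂)
      rw [lt_div_iff₀ hπ, ← abs_of_pos hπ, ← abs_mul, abs_of_pos hπ] at hv
      refine (congrArg abs ?_).trans_lt hv
      field_simp
    refine ⟨m, fun N => ?_⟩
    refine (abs_sum_range_le_of_antiperiodic habs (m := m)
      (p := fun n => |sin (n * θ₁)| ≤ δ₁ ∨ |sin (n * θ₂)| ≤ δ₂) ?_ N).trans ?_
    · intro n hn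
      rw [not_or, not_le, not_le] at hn
      have e₁ : SignType.sign (sin ((n + m : ℕ) * θ₁)) = - SignType.sign (sin (n * θ₁)) := by
        rw [← sign_sin_eq_of_abs_sub_lt (x := n * θ₁)
          (y := (n + m : ℕ) * θ₁ - π - u * (2 * π)), sin_sub_int_mul_two_pi, sin_sub_pi,
          Left.sign_neg, neg_neg]
        refine lt_trans ?_ hn.1
        refine (congrArg abs ?_).trans_lt hu'
        push_cast
        ring
      have e₂ : SignType.sign (sin ((n + m : ℕ) * θ₂)) = SignType.sign (sin (n * θ₂)) := by
        rw [← sign_sin_eq_of_abs_sub_lt (x := n * θ₂)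
          (y := (n + m : ℕ) * θ₂ - v * (2 * π)), sin_sub_int_mul_two_pi]
        refine lt_trans ?_ hn.2
        refine (congrArg abs ?_).trans_lt hv'
        push_cast
        ring
      simp only [ha]
      rw [sign_mul, e₁, e₂, sign_mul, neg_mul, SignType.coe_neg]
    · rw [Finset.filter_or]
      have hcard := (Finset.card_union_le _ _).trans (add_le_add (hc₁ N) (hc₂ N))
      have hcard' := (Nat.cast_le (α := ℝ)).2 hcard
      have hdiv : ((N / K : ℕ) : ℝ) ≤ N / K := Nat.cast_div_le
      push_cast at hcard'
      linarith
  rw [Metric.tendsto_atTop]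
  intro ε hε
  obtain ⟨k, hk⟩ := exists_nat_one_div_lt (show 0 < ε / 4 by positivity)
  obtain ⟨m, hm⟩ := bound (k + 1) k.succ_pos
  obtain ⟨M, hM⟩ := exists_nat_gt ((2 + m) / (ε / 2))
  refine ⟨M + 1, fun N hN => ?_⟩
  have hN0 : (0 : ℝ) < N := by exact_mod_cast (by omega : 0 < N)
  have hMN : (M : ℝ) ≤ N := by exact_mod_cast (by omega : M ≤ N)
  rw [Real.dist_eq, sub_zero, abs_div, abs_of_pos hN0, div_lt_iff₀ hN0]
  refine (hm N).trans_lt ?_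
  rw [div_lt_iff₀ (by positivity)] at hM
  have h5 : (N : ℝ) / (k + 1 : ℕ) ≤ ε / 4 * N := by
    rw [div_eq_mul_one_div, mul_comm]
    push_cast
    gcongr
  nlinarith

/-- Analytic core of Theorem 1.1 (positive-sign case): if `1, θ₁/(2π), θ₂/(2π)` are
linearly independent over `ℚ`, the set of `ν` with `λ₁(ν)λ₂(ν) > 0` has natural density `1/2`,
where `λᵢ(ν) = sin((ν+1)θᵢ)/sin θᵢ`. -/
theorem simultaneous_sign_density_pos
    (θ₁ θ₂ : ℝ) (h₁ : θ₁ ∈ Set.Ioo 0 π) (h₂ : θ₂ ∈ Set.Ioo 0 π)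
    (hind : ∀ a b c : ℚ,
      (a : ℝ) + (b : ℝ) * (θ₁ / (2 * π)) + (c : ℝ) * (θ₂ / (2 * π)) = 0 →
      a = 0 ∧ b = 0 ∧ c = 0) :
    Tendsto (fun x : ℕ =>
      (Nat.card {ν : ℕ | 1 ≤ ν ∧ ν ≤ x ∧
        0 < (Real.sin (((ν : ℝ) + 1) * θ₁) / Real.sin θ₁) *
            (Real.sin (((ν : ℝ) + 1) * θ₂) / Real.sin θ₂)} : ℝ) / (x : ℝ))
      atTop (nhds (1 / 2)) := by
  have irr : ∀ {θ : ℝ}, (∀ a b : ℚ, (a : ℝ) + b * (θ / (2 * π)) = 0 → b = 0) →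
      ∀ n : ℕ, 0 < n → sin (n * θ) ≠ 0 := by
    intro θ h n hn h0
    obtain ⟨k, hk⟩ := sin_eq_zero_iff.1 h0
    have hπ := pi_ne_zero
    have : (n : ℚ) = 0 := h (-(k / 2)) n (by
      push_cast
      field_simp
      linarith)
    exact hn.ne' (by exact_mod_cast this)
  have hs₁ := irr fun a b hab => (hind a b 0 (by simpa using hab)).2.1
  have hs₂ := irr fun a b hab => (hind a 0 b (by simpa using hab)).2.2
  have hmean := tendsto_mean_sign_sin_mul_sin hind hs₁ hs₂
  set a : ℕ → ℝ := fun n => (SignType.sign (sin (n * θ₁) * sin (n * θ₂)) : ℝ) with ha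
  have hcount : ∀ x : ℕ, (Nat.card {ν : ℕ | 1 ≤ ν ∧ ν ≤ x ∧
        0 < (Real.sin (((ν : ℝ) + 1) * θ₁) / Real.sin θ₁) *
            (Real.sin (((ν : ℝ) + 1) * θ₂) / Real.sin θ₂)} : ℝ)
      = x / 2 + ((∑ n ∈ Finset.range (x + 2), a n) - (a 0 + a 1)) / 2 := by
    intro x
    have hset : {ν : ℕ | 1 ≤ ν ∧ ν ≤ x ∧
        0 < (Real.sin (((ν : ℝ) + 1) * θ₁) / Real.sin θ₁) *
            (Real.sin (((ν : ℝ) + 1) * θ₂) / Real.sin θ₂)}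
        = ((Finset.Icc 1 x).filter fun ν : ℕ =>
            0 < sin ((ν + 1 : ℕ) * θ₁) * sin ((ν + 1 : ℕ) * θ₂) : Finset ℕ) := by
      ext ν
      have hp := mul_pos (sin_pos_of_mem_Ioo h₁) (sin_pos_of_mem_Ioo h₂)
      simp only [Set.mem_ofPred_eq, Finset.coe_filter, Finset.mem_Icc, and_assoc,
        div_mul_div_comm, div_pos_iff_of_pos_right hp, Nat.cast_add, Nat.cast_one]
    rw [hset, Nat.card_coe_set_eq, Set.ncard_coe_finset, Finset.card_filter, Nat.cast_sum]
    have hterm : ∀ ν : ℕ, (((if 0 < sin ((ν + 1 : ℕ) * θ₁) * sin ((ν + 1 : ℕ) * θ₂)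
        then 1 else 0 : ℕ)) : ℝ) = 1 / 2 + a (ν + 1) / 2 := by
      intro ν
      have hne := mul_ne_zero (hs₁ (ν + 1) ν.succ_pos) (hs₂ (ν + 1) ν.succ_pos)
      simp only [ha]
      rcases hne.lt_or_gt with h | h
      · rw [if_neg h.not_gt, sign_neg h]
        norm_num
      · rw [if_pos h, sign_pos h]
        norm_num
    rw [Finset.sum_congr rfl fun ν _ => hterm ν,
      Finset.sum_range_succ', Finset.sum_range_succ', Finset.sum_add_distrib, ← Finset.sum_div,
      ← Finset.sum_div, ← Finset.Ico_add_one_right_eq_Icc, Finset.sum_Ico_eq_sum_range,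
      Finset.sum_Ico_eq_sum_range]
    simp only [Finset.sum_const, Finset.card_range, Nat.add_sub_cancel, nsmul_eq_mul,
      add_comm 1, zero_add]
    ring
  have hratio : Tendsto (fun x : ℕ => ((x + 2 : ℕ) : ℝ) / x) atTop (nhds 1) := by
    have h := (tendsto_const_div_atTop_nhds_zero_nat (2 : ℝ)).const_add 1
    rw [add_zero] at h
    refine h.congr' ?_
    filter_upwards [eventually_gt_atTop 0] with x hx
    have : (x : ℝ) ≠ 0 := by positivity
    push_cast
    field_simp
  have hlim := ((((hmean.comp (tendsto_add_atTop_nat 2)).mul hratio).sub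
    (tendsto_const_div_atTop_nhds_zero_nat (a 0 + a 1))).div_const 2).const_add (1 / 2)
  simp only [zero_mul, sub_zero, zero_div, add_zero] at hlim
  refine hlim.congr' ?_
  filter_upwards [eventually_gt_atTop 0] with x hx
  have hx0 : (x : ℝ) ≠ 0 := by positivity
  have hx2 : ((x + 2 : ℕ) : ℝ) ≠ 0 := by positivity
  rw [hcount, Function.comp_apply, div_mul_div_cancel₀ hx2]
  field_simp
end

section
/- Let θ₁, θ₂ ∈ (0, π) be real numbers such that 1, θ₁/(2π), θ₂/(2π) are linearly independent over ℚ. For i = 1, 2 and each positive integer ν define λᵢ(ν) = sin((ν+1)θᵢ)/sin(θᵢ). Then lim_{x→∞} (1/x)·#{ν ≤ x : λ₁(ν)·λ₂(ν) < 0} = 1/2. -/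
open Real Filter

section TorusEquidistribution

open MeasureTheory Topology

instance : IsProbabilityMeasure (volume : Measure UnitAddCircle) :=
  ⟨UnitAddCircle.measure_univ⟩

variable {d : Type*} [Fintype d]

lemma mFourier_add_apply (n : d → ℤ) (x y : UnitAddTorus d) :
    UnitAddTorus.mFourier n (x + y) = UnitAddTorus.mFourier n x * UnitAddTorus.mFourier n y := by
  simp [UnitAddTorus.mFourier, fourier_apply, AddCircle.toCircle_add, Finset.prod_mul_distrib]

lemma mFourier_add_nsmul_apply (n : d → ℤ) (x y : UnitAddTorus d) (k : ℕ) :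
    UnitAddTorus.mFourier n (x + k • y) =
      UnitAddTorus.mFourier n x * UnitAddTorus.mFourier n y ^ k := by
  induction k with
  | zero => simp
  | succ k ih => rw [succ_nsmul, ← add_assoc, mFourier_add_apply, ih, pow_succ, mul_assoc]

lemma norm_mFourier_apply (n : d → ℤ) (x : UnitAddTorus d) :
    ‖UnitAddTorus.mFourier n x‖ = 1 := by
  simp only [UnitAddTorus.mFourier, ContinuousMap.coe_mk, norm_prod, fourier_apply]
  exact Finset.prod_eq_one fun i _ ↦ Circle.norm_coe _

lemma integral_mFourier_eq_zero {n : d → ℤ} {α : UnitAddTorus d}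
    (h : UnitAddTorus.mFourier n α ≠ 1) : ∫ x, UnitAddTorus.mFourier n x = 0 := by
  have key := integral_add_right_eq_self (μ := (volume : Measure (UnitAddTorus d)))
    (fun x ↦ UnitAddTorus.mFourier n x) α
  simp only [mFourier_add_apply, integral_mul_const] at key
  by_contra h0
  exact h (mul_left_cancel₀ h0 (key.trans (mul_one _).symm))

lemma tendsto_inv_mul_geom_sum_zero {z : ℂ} (hz : ‖z‖ = 1) (hz1 : z ≠ 1) :
    Tendsto (fun N : ℕ ↦ (N : ℂ)⁻¹ * ∑ k ∈ Finset.range N, z ^ k) atTop (𝓝 0) := by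
  have hlim : Tendsto (fun N : ℕ ↦ (N : ℝ)⁻¹ * (2 / ‖z - 1‖)) atTop (𝓝 0) := by
    simpa using (tendsto_inv_atTop_nhds_zero_nat (𝕜 := ℝ)).mul_const (2 / ‖z - 1‖)
  refine squeeze_zero_norm (fun N ↦ ?_) hlim
  rw [geom_sum_eq hz1, norm_mul, norm_inv, Complex.norm_natCast, norm_div]
  gcongr
  calc ‖z ^ N - 1‖ ≤ ‖z ^ N‖ + ‖(1 : ℂ)‖ := norm_sub_le _ _
    _ = 2 := by rw [norm_pow, hz]; norm_num

/-- Weyl's equidistribution theorem on the torus, for complex continuous test functions. -/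
theorem tendsto_average_orbit_integral {α : UnitAddTorus d}
    (hα : ∀ n : d → ℤ, n ≠ 0 → UnitAddTorus.mFourier n α ≠ 1) (b : UnitAddTorus d)
    (f : C(UnitAddTorus d, ℂ)) :
    Tendsto (fun N : ℕ ↦ (N : ℂ)⁻¹ * ∑ k ∈ Finset.range N, f (b + k • α)) atTop
      (𝓝 (∫ x, f x)) := by
  let K : C(UnitAddTorus d, ℂ) → C(UnitAddTorus d, ℂ) := fun f ↦ f.comp (.addRight α)
  have hK (k : ℕ) (f : C(UnitAddTorus d, ℂ)) : K^[k] f b = f (b + k • α) := by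
    induction k generalizing f with
    | zero => simp
    | succ k ih =>
      rw [Function.iterate_succ_apply, ih, succ_nsmul, ← add_assoc]
      rfl
  have hsum (f : C(UnitAddTorus d, ℂ)) (N : ℕ) :
      birkhoffAverage ℂ K (fun g ↦ g b) N f =
        (N : ℂ)⁻¹ * ∑ k ∈ Finset.range N, f (b + k • α) := by
    simp [birkhoffAverage, birkhoffSum, hK]
  have hintegrable (f : C(UnitAddTorus d, ℂ)) : Integrable f (volume : Measure (UnitAddTorus d)) :=
    f.continuous.integrable_of_hasCompactSupport (.of_compactSpace f)
  have hclosed : IsClosed {f : C(UnitAddTorus d, ℂ) |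
      Tendsto (birkhoffAverage ℂ K (fun g ↦ g b) · f) atTop (𝓝 (∫ x, f x))} := by
    refine isClosed_setOfPred_tendsto_birkhoffAverage ℂ ?_ ?_ ?_
    · refine LipschitzWith.of_dist_le_mul fun f g ↦ ?_
      simp only [NNReal.coe_one, one_mul]
      exact (ContinuousMap.dist_le dist_nonneg).2 fun x ↦
        ContinuousMap.dist_apply_le_dist (f := f) (g := g) (x + α)
    · refine (LipschitzWith.of_dist_le_mul (K := 1) fun f g ↦ ?_).uniformContinuous
      simpa using ContinuousMap.dist_apply_le_dist (f := f) (g := g) b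
    · refine (LipschitzWith.of_dist_le_mul (K := 1) fun f g ↦ ?_).continuous
      rw [dist_eq_norm, ← integral_sub (hintegrable f) (hintegrable g), NNReal.coe_one, one_mul, dist_eq_norm]
      refine (norm_integral_le_of_norm_le_const (C := ‖f - g‖)
        (.of_forall fun x ↦ (f - g).norm_coe_le_norm x)).trans ?_
      simp
  have hspan : ∀ g ∈ Submodule.span ℂ (Set.range (UnitAddTorus.mFourier (d := d))),
      Tendsto (birkhoffAverage ℂ K (fun g ↦ g b) · g) atTop (𝓝 (∫ x, g x)) := by
    intro g hg
    simp only [hsum]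
    induction hg using Submodule.span_induction with
    | mem g hg =>
      obtain ⟨n, rfl⟩ := hg
      by_cases hn : n = 0
      · subst hn
        refine tendsto_const_nhds.congr' ?_
        filter_upwards [eventually_ne_atTop 0] with N hN
        have : (N : ℂ) ≠ 0 := by exact_mod_cast hN
        simp [UnitAddTorus.mFourier_zero, this]
      · rw [integral_mFourier_eq_zero (hα n hn)]
        simp only [mFourier_add_nsmul_apply, ← Finset.mul_sum]
        simpa [mul_left_comm] using (tendsto_inv_mul_geom_sum_zero
          (norm_mFourier_apply n α) (hα n hn)).const_mul (UnitAddTorus.mFourier n b)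
    | zero => simp
    | add f g _ _ hf hg =>
      simp only [ContinuousMap.add_apply, Finset.sum_add_distrib, mul_add]
      rw [integral_add (hintegrable f) (hintegrable g)]
      exact hf.add hg
    | smul a f _ hf =>
      simp only [ContinuousMap.smul_apply, smul_eq_mul, ← Finset.mul_sum]
      rw [integral_const_mul]
      simpa [mul_left_comm] using hf.const_mul a
  have hmem : f ∈ (Submodule.span ℂ
      (Set.range (UnitAddTorus.mFourier (d := d)))).topologicalClosure := by
    rw [UnitAddTorus.span_mFourier_closure_eq_top]; trivial
  have := closure_minimal (t := {f : C(UnitAddTorus d, ℂ) |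
    Tendsto (birkhoffAverage ℂ K (fun g ↦ g b) · f) atTop (𝓝 (∫ x, f x))}) hspan hclosed hmem
  simpa only [Set.mem_ofPred_eq, hsum] using this

/-- Weyl's equidistribution theorem on the torus, for sets with null frontier. -/
theorem tendsto_card_orbit_mem_div {α : UnitAddTorus d}
    (hα : ∀ n : d → ℤ, n ≠ 0 → UnitAddTorus.mFourier n α ≠ 1) (b : UnitAddTorus d)
    {E : Set (UnitAddTorus d)} (hE : MeasurableSet E) (hfr : volume (frontier E) = 0) :
    Tendsto (fun N : ℕ ↦ (Nat.card {k : ℕ | k < N ∧ b + k • α ∈ E} : ℝ) / N) atTop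
      (𝓝 (volume.real E)) := by
  classical
  let m (N : ℕ) : Measure (UnitAddTorus d) :=
    ((N + 1 : ℕ) : ENNReal)⁻¹ • ∑ k ∈ Finset.range (N + 1), Measure.dirac (b + k • α)
  have hm (N : ℕ) : IsProbabilityMeasure (m N) := by
    constructor
    simp only [m, Measure.smul_apply, Measure.finsetSum_apply, measure_univ, Finset.sum_const,
      Finset.card_range, nsmul_eq_mul, mul_one, smul_eq_mul]
    exact ENNReal.inv_mul_cancel (by simp) (by simp)
  let μs (N : ℕ) : ProbabilityMeasure (UnitAddTorus d) := ⟨m N, hm N⟩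
  let μ : ProbabilityMeasure (UnitAddTorus d) := ⟨volume, inferInstance⟩
  have hlim : Tendsto μs atTop (𝓝 μ) := by
    rw [ProbabilityMeasure.tendsto_iff_forall_integral_rclike_tendsto ℂ]
    intro f
    refine ((tendsto_add_atTop_iff_nat 1).2
      (tendsto_average_orbit_integral hα b f.toContinuousMap)).congr fun N ↦ ?_
    simp only [μs, m, ProbabilityMeasure.coe_mk, integral_smul_measure]
    rw [integral_finsetSum_measure fun k _ ↦ integrable_dirac (by simp)]
    simp [integral_dirac, -Nat.cast_add]
  have key := ProbabilityMeasure.tendsto_measure_of_null_frontier_of_tendsto' hlim hfr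
  have key' := (ENNReal.tendsto_toReal (measure_ne_top _ E)).comp key
  refine (tendsto_add_atTop_iff_nat 1).1 (key'.congr fun N ↦ ?_)
  have hset : {k : ℕ | k < N + 1 ∧ b + k • α ∈ E} =
      ((Finset.range (N + 1)).filter fun k ↦ b + k • α ∈ E : Finset ℕ) := by
    ext; simp
  rw [hset, Nat.card_eq_card_toFinset, Finset.toFinset_coe]
  simp [μs, m, Measure.dirac_apply' _ hE, Set.indicator_apply, div_eq_inv_mul,
    -Nat.cast_add]

/-- The function `t ↦ sin (2πt)` on the circle `ℝ / ℤ`. -/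
noncomputable def circleSin (t : UnitAddCircle) : ℝ := (fourier 1 t).im

lemma continuous_circleSin : Continuous circleSin := by
  unfold circleSin; fun_prop

lemma circleSin_neg (t : UnitAddCircle) : circleSin (-t) = -circleSin t := by
  simp [circleSin, fourier_apply, AddCircle.toCircle_neg]

lemma circleSin_coe (t : ℝ) : circleSin (t : UnitAddCircle) = Real.sin (2 * π * t) := by
  rw [circleSin, fourier_coe_apply, ← Complex.exp_ofReal_mul_I_im]
  congr 2
  push_cast
  ring

lemma volume_circleSin_eq_zero : volume {t : UnitAddCircle | circleSin t = 0} = 0 := by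
  have hfin : {t : UnitAddCircle | circleSin t = 0}.Finite := by
    refine (AddCircle.finite_torsion (1 : ℝ) two_pos).subset fun t ht ↦ ?_
    obtain ⟨x, rfl⟩ := QuotientAddGroup.mk_surjective t
    have ht : circleSin (x : UnitAddCircle) = 0 := ht
    rw [circleSin_coe, Real.sin_eq_zero_iff] at ht
    obtain ⟨n, hn⟩ := ht
    have : 2 * x = n := by
      have := pi_pos
      field_simp at hn
      linarith
    change 2 • (x : UnitAddCircle) = 0
    rw [← AddCircle.coe_nsmul, AddCircle.coe_eq_zero_iff]
    exact ⟨n, by simp [this]⟩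
  rw [← Set.biUnion_of_singleton {t : UnitAddCircle | circleSin t = 0}]
  refine (measure_biUnion_null_iff hfin.countable).2 fun t _ ↦ ?_
  simpa using AddCircle.volume_closedBall (T := 1) (x := t) 0

/-- The product of the two coordinate sines on the two-dimensional torus. -/
noncomputable def torusSinMul (x : UnitAddTorus (Fin 2)) : ℝ := circleSin (x 0) * circleSin (x 1)

lemma continuous_torusSinMul : Continuous torusSinMul :=
  (continuous_circleSin.comp (continuous_apply 0)).mul
    (continuous_circleSin.comp (continuous_apply 1))

lemma volume_torusSinMul_eq_zero : volume {x | torusSinMul x = 0} = 0 := by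
  have h (i : Fin 2) : volume {x : UnitAddTorus (Fin 2) | circleSin (x i) = 0} = 0 := by
    have := (measurePreserving_eval
      (fun _ : Fin 2 ↦ (volume : Measure UnitAddCircle)) i).measure_preimage
      (isClosed_eq continuous_circleSin (continuous_const (y := 0))).nullMeasurableSet
    exact this.trans volume_circleSin_eq_zero
  refine measure_mono_null (fun x hx ↦ ?_) (measure_union_null (h 0) (h 1))
  exact mul_eq_zero.1 hx

lemma volume_frontier_torusSinMul_neg : volume (frontier {x | torusSinMul x < 0}) = 0 :=
  measure_mono_null (frontier_lt_subset_eq continuous_torusSinMul continuous_const)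
    volume_torusSinMul_eq_zero

lemma measurableSet_torusSinMul_neg : MeasurableSet {x | torusSinMul x < 0} :=
  (isOpen_lt continuous_torusSinMul continuous_const).measurableSet

lemma volume_real_torusSinMul_neg : volume.real {x | torusSinMul x < 0} = 1 / 2 := by
  let g (i : Fin 2) : UnitAddCircle → UnitAddCircle := if i = 0 then Neg.neg else id
  have hg : MeasurePreserving (fun (x : UnitAddTorus (Fin 2)) i ↦ g i (x i)) := by
    refine volume_preserving_pi fun i ↦ ?_
    by_cases hi : i = 0
    · simpa only [g, hi, if_true] using Measure.measurePreserving_neg _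
    · simpa only [g, hi, if_false] using MeasurePreserving.id _
  have hflip (x : UnitAddTorus (Fin 2)) :
      torusSinMul (fun i ↦ g i (x i)) = -torusSinMul x := by
    simp [torusSinMul, g, circleSin_neg]
  have hpos : volume.real {x | 0 < torusSinMul x} = volume.real {x | torusSinMul x < 0} := by
    rw [← hg.measureReal_preimage measurableSet_torusSinMul_neg.nullMeasurableSet]
    simp [Set.preimage, hflip]
  have hcompl : volume.real {x | torusSinMul x < 0}ᶜ = volume.real {x | 0 < torusSinMul x} := by
    refine measureReal_congr ?_
    filter_upwards [compl_mem_ae_iff.2 volume_torusSinMul_eq_zero] with x hx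
    have hx : torusSinMul x ≠ 0 := hx
    exact propext (not_lt.trans hx.symm.le_iff_lt)
  have htotal := probReal_compl_eq_one_sub (μ := (volume : Measure (UnitAddTorus (Fin 2))))
    measurableSet_torusSinMul_neg
  linarith

end TorusEquidistribution

/-- Analytic core of Theorem 1.1 (negative-sign case): if `1, θ₁/(2π), θ₂/(2π)` are
linearly independent over `ℚ`, the set of `ν` with `λ₁(ν)λ₂(ν) < 0` has natural density `1/2`,
where `λᵢ(ν) = sin((ν+1)θᵢ)/sin θᵢ`. -/
theorem simultaneous_sign_density_neg
    (θ₁ θ₂ : ℝ) (h₁ : θ₁ ∈ Set.Ioo 0 π) (h₂ : θ₂ ∈ Set.Ioo 0 π)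
    (hind : ∀ a b c : ℚ,
      (a : ℝ) + (b : ℝ) * (θ₁ / (2 * π)) + (c : ℝ) * (θ₂ / (2 * π)) = 0 →
      a = 0 ∧ b = 0 ∧ c = 0) :
    Tendsto (fun x : ℕ =>
      (Nat.card {ν : ℕ | 1 ≤ ν ∧ ν ≤ x ∧
        (Real.sin (((ν : ℝ) + 1) * θ₁) / Real.sin θ₁) *
            (Real.sin (((ν : ℝ) + 1) * θ₂) / Real.sin θ₂) < 0} : ℝ) / (x : ℝ))
      atTop (nhds (1 / 2)) := by
  let t : Fin 2 → ℝ := ![θ₁ / (2 * π), θ₂ / (2 * π)]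
  let α : UnitAddTorus (Fin 2) := fun i ↦ (t i : UnitAddCircle)
  have hα (n : Fin 2 → ℤ) (hn : n ≠ 0) : UnitAddTorus.mFourier n α ≠ 1 := by
    intro h
    have hexp : UnitAddTorus.mFourier n α =
        Complex.exp ((n 0 * t 0 + n 1 * t 1) * (2 * π * Complex.I)) := by
      simp only [UnitAddTorus.mFourier, ContinuousMap.coe_mk, Fin.prod_univ_two, α,
        fourier_coe_apply, ← Complex.exp_add]
      congr 1
      push_cast
      ring
    rw [hexp, Complex.exp_eq_one_iff] at h
    obtain ⟨m, hm⟩ := h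
    have hm' := mul_right_cancel₀ Complex.two_pi_I_ne_zero hm
    have hm'' : (n 0 : ℝ) * t 0 + n 1 * t 1 = m := by exact_mod_cast hm'
    obtain ⟨-, h0, h1⟩ := hind (-m) (n 0) (n 1) (by
      simp only [t, Matrix.cons_val_zero, Matrix.cons_val_one] at hm''
      push_cast
      linarith)
    refine hn (funext fun i ↦ ?_)
    fin_cases i
    · exact_mod_cast h0
    · exact_mod_cast h1
  have hlim := tendsto_card_orbit_mem_div hα (2 • α) measurableSet_torusSinMul_neg
    volume_frontier_torusSinMul_neg
  rw [volume_real_torusSinMul_neg] at hlim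
  refine hlim.congr fun N ↦ ?_
  have hs₁ := Real.sin_pos_of_mem_Ioo h₁
  have hs₂ := Real.sin_pos_of_mem_Ioo h₂
  have hval (k : ℕ) : torusSinMul (2 • α + k • α) =
      Real.sin (((k + 1 : ℕ) + 1) * θ₁) * Real.sin (((k + 1 : ℕ) + 1) * θ₂) := by
    have h (i : Fin 2) : (2 • α + k • α) i = (((k + 2 : ℝ) * t i : ℝ) : UnitAddCircle) := by
      simp only [α, Pi.add_apply, Pi.smul_apply, ← AddCircle.coe_nsmul, ← AddCircle.coe_add]
      congr 1
      simp only [nsmul_eq_mul]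
      push_cast
      ring
    simp only [torusSinMul, h, circleSin_coe, t, Matrix.cons_val_zero, Matrix.cons_val_one]
    congr 2
    · push_cast
      field_simp
      ring
    · push_cast
      field_simp
      ring
  have hiff (k : ℕ) : torusSinMul (2 • α + k • α) < 0 ↔
      (Real.sin (((k + 1 : ℕ) + 1) * θ₁) / Real.sin θ₁) *
        (Real.sin (((k + 1 : ℕ) + 1) * θ₂) / Real.sin θ₂) < 0 := by
    rw [hval, div_mul_div_comm, div_lt_iff₀ (mul_pos hs₁ hs₂), zero_mul]
  congr 2
  refine Nat.card_congr (Equiv.ofBijective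
    (fun k ↦ ⟨k.1 + 1, Nat.le_add_left _ _, k.2.1, (hiff k.1).1 k.2.2⟩)
    ⟨fun k l h ↦ ?_, fun ⟨ν, h1, hN, hν⟩ ↦ ?_⟩)
  · exact Subtype.ext (Nat.succ_injective (congrArg Subtype.val h))
  · obtain ⟨k, rfl⟩ := Nat.exists_eq_add_of_le' h1
    exact ⟨⟨k, hN, (hiff k).2 hν⟩, rfl⟩
end
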